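/- (Proposition 3.4(i)) For each ε = (ε1, ε2, ε3) with ε_j ∈ {-1, 1}, the linear map Φ^ε : ℝ⁶ → ℝ⁶ given by Φ^ε(x1, x2, x3, y1, y2, y3) = (x1, x2, x3, ε1 y1, ε2 y2, ε3 y3) maps M̃⁴ into M̃⁴, and for every p ∈ M̃⁴ and every j ∈ {1,2,3} one has Φ^ε(X_j(p)) = ε_j · X_j(Φ^ε(p)). -/

import Mathlib

noncomputable section

/-- `ℝ⁶` with its Euclidean inner product; coordinates `p 0, p 1, p 2` are `x₁, x₂, x₃`
and `p 3, p 4, p 5` are `y₁, y₂, y₃`. -/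
abbrev E6 := EuclideanSpace ℝ (Fin 6)

/-- The point of `ℝ⁶` with the given six coordinates. -/
noncomputable def mk6 (a b c d e f : ℝ) : E6 :=
  (EuclideanSpace.equiv (Fin 6) ℝ).symm ![a, b, c, d, e, f]

/-- The polynomial `F` of Proposition 3.2. -/
noncomputable def Fq (p : E6) : ℝ :=
  9 * (p 0) ^ 2 * (p 2) ^ 8 * ((p 1) ^ 2 + (p 2) ^ 2) * (p 3) ^ 2
    + 9 * (p 0) ^ 8 * (p 1) ^ 2 * ((p 0) ^ 2 - (p 2) ^ 2) * (p 4) ^ 2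
    - 9 * (p 1) ^ 8 * (p 2) ^ 2 * ((p 0) ^ 2 + (p 1) ^ 2) * (p 5) ^ 2
    - (p 0) ^ 2 * (p 1) ^ 2 * (p 2) ^ 2 *
      (2 * (p 0) ^ 2 * (p 1) ^ 4 - 2 * (p 0) ^ 2 * (p 2) ^ 4 - 2 * (p 1) ^ 2 * (p 2) ^ 4
        - (p 0) ^ 2 * (p 1) ^ 2 * (p 2) ^ 2)

/-- The polynomial `G` of Proposition 3.2. -/
noncomputable def Gq (p : E6) : ℝ := (p 1) ^ 2 - (p 0) ^ 2 - (p 2) ^ 2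

/-- The algebraic variety `M⁴`. -/
def M4 : Set E6 :=
  {p | Fq p = 0 ∧ Gq p = 0 ∧ 0 < p 0 ∧ 0 < p 1 ∧ 0 < p 2 ∧ ¬(p 3 = 0 ∧ p 4 = 0 ∧ p 5 = 0)}

/-- The half line `ℓ₊`: points of `M⁴` with `x = s(1, √2, 1)`, `s > 0`, `y = (0, 1, 0)`. -/
def ellP : Set E6 :=
  {p ∈ M4 | ∃ s : ℝ, 0 < s ∧ p 0 = s ∧ p 1 = s * Real.sqrt 2 ∧ p 2 = s ∧
    p 3 = 0 ∧ p 4 = 1 ∧ p 5 = 0}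

/-- The half line `ℓ₋`: points of `M⁴` with `x = s(1, √2, 1)`, `s > 0`, `y = (0, -1, 0)`. -/
def ellM : Set E6 :=
  {p ∈ M4 | ∃ s : ℝ, 0 < s ∧ p 0 = s ∧ p 1 = s * Real.sqrt 2 ∧ p 2 = s ∧
    p 3 = 0 ∧ p 4 = -1 ∧ p 5 = 0}

/-- The regular part `M̃⁴ = M⁴ \ (ℓ₋ ∪ ℓ₊)`. -/
def Mt4 : Set E6 := M4 \ (ellM ∪ ellP)

/-- `A₁` of Proposition 3.3. -/
noncomputable def A1 (p : E6) : ℝ :=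
  (1 / (p 1) ^ 4) * (3 * (p 1) ^ 4 - (p 2) ^ 4) * (p 3) ^ 2
    - ((p 0) ^ 6 / (p 2) ^ 8) * (3 * (p 0) ^ 2 - 2 * (p 2) ^ 2) * (p 4) ^ 2
    + ((p 1) ^ 4 / ((p 0) ^ 2 * (p 2) ^ 4)) * (3 * (p 0) ^ 2 + 2 * (p 1) ^ 2) * (p 5) ^ 2
    + (1 / (9 * (p 2) ^ 4)) * (5 * (p 0) ^ 4 + 2 * (p 1) ^ 2 * (p 2) ^ 2)

/-- `A₂` of Proposition 3.3. -/
noncomputable def A2 (p : E6) : ℝ :=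
  -((p 2) ^ 4 / ((p 0) ^ 4 * (p 1) ^ 2)) * (3 * (p 1) ^ 2 + 2 * (p 2) ^ 2) * (p 3) ^ 2
    - (1 / (p 2) ^ 4) * ((p 0) ^ 4 - 3 * (p 2) ^ 4) * (p 4) ^ 2
    - ((p 1) ^ 6 / (p 0) ^ 8) * (2 * (p 0) ^ 2 + 3 * (p 1) ^ 2) * (p 5) ^ 2
    - (1 / (9 * (p 0) ^ 4)) * (5 * (p 1) ^ 4 - 2 * (p 0) ^ 2 * (p 2) ^ 2)

/-- `A₃` of Proposition 3.3. -/
noncomputable def A3 (p : E6) : ℝ :=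
  ((p 2) ^ 6 / (p 1) ^ 8) * (2 * (p 1) ^ 2 + 3 * (p 2) ^ 2) * (p 3) ^ 2
    + ((p 0) ^ 4 / ((p 1) ^ 4 * (p 2) ^ 2)) * (2 * (p 0) ^ 2 - 3 * (p 2) ^ 2) * (p 4) ^ 2
    + (1 / (p 0) ^ 4) * (3 * (p 0) ^ 4 - (p 1) ^ 4) * (p 5) ^ 2
    + (1 / (9 * (p 1) ^ 4)) * (5 * (p 2) ^ 4 + 2 * (p 0) ^ 2 * (p 1) ^ 2)

/-- The vector field `X₁` of Proposition 3.3. -/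
noncomputable def X1 (p : E6) : E6 :=
  mk6 ((1 / (p 1) ^ 4) * (((p 1) ^ 4 + (p 1) ^ 2 * (p 2) ^ 2 + (p 2) ^ 4) * p 0 * p 3))
      ((1 / (p 1) ^ 4) * ((p 1) ^ 5 * p 3))
      ((1 / (p 1) ^ 4) * ((p 2) ^ 5 * p 3))
      ((1 / (p 1) ^ 4) * ((p 1) ^ 4 * A1 p))
      ((1 / (p 1) ^ 4) * (2 * (p 0) ^ 2 * (p 1) ^ 2 * p 3 * p 4))
      ((1 / (p 1) ^ 4) * ((8 * (p 2) ^ 2 + 2 * (p 0) ^ 2) * (p 2) ^ 2 * p 3 * p 5))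

/-- The vector field `X₂` of Proposition 3.3. -/
noncomputable def X2 (p : E6) : E6 :=
  mk6 ((1 / (p 2) ^ 4) * ((p 0) ^ 5 * p 4))
      ((1 / (p 2) ^ 4) * (((p 0) ^ 4 - (p 0) ^ 2 * (p 2) ^ 2 + (p 2) ^ 4) * p 1 * p 4))
      ((1 / (p 2) ^ 4) * ((p 2) ^ 5 * p 4))
      ((1 / (p 2) ^ 4) * ((8 * (p 0) ^ 2 - 2 * (p 1) ^ 2) * (p 0) ^ 2 * p 3 * p 4))
      ((1 / (p 2) ^ 4) * ((p 2) ^ 4 * A2 p))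
      ((1 / (p 2) ^ 4) * (2 * (p 1) ^ 2 * (p 2) ^ 2 * p 4 * p 5))

/-- The vector field `X₃` of Proposition 3.3. -/
noncomputable def X3 (p : E6) : E6 :=
  mk6 ((1 / (p 0) ^ 4) * ((p 0) ^ 5 * p 5))
      ((1 / (p 0) ^ 4) * ((p 1) ^ 5 * p 5))
      ((1 / (p 0) ^ 4) * (((p 0) ^ 4 + (p 0) ^ 2 * (p 1) ^ 2 + (p 1) ^ 4) * p 2 * p 5))
      ((1 / (p 0) ^ 4) * (-2 * (p 0) ^ 2 * (p 2) ^ 2 * p 3 * p 5))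
      ((1 / (p 0) ^ 4) * ((8 * (p 1) ^ 2 - 2 * (p 2) ^ 2) * (p 1) ^ 2 * p 4 * p 5))
      ((1 / (p 0) ^ 4) * ((p 0) ^ 4 * A3 p))

/-- The indexed family `X₁, X₂, X₃`. -/
noncomputable def Xv : Fin 3 → E6 → E6 := ![X1, X2, X3]

/-- The involution `Φ^ε(x, y) = (x, ε₁y₁, ε₂y₂, ε₃y₃)`. -/
noncomputable def PhiEps (e : Fin 3 → ℝ) (p : E6) : E6 :=
  mk6 (p 0) (p 1) (p 2) (e 0 * p 3) (e 1 * p 4) (e 2 * p 5)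

@[simp] theorem mk6_zero (a b c d e f : ℝ) : mk6 a b c d e f 0 = a := rfl

@[simp] theorem mk6_one (a b c d e f : ℝ) : mk6 a b c d e f 1 = b := rfl

@[simp] theorem mk6_two (a b c d e f : ℝ) : mk6 a b c d e f 2 = c := rfl

@[simp] theorem mk6_three (a b c d e f : ℝ) : mk6 a b c d e f 3 = d := rfl

@[simp] theorem mk6_four (a b c d e f : ℝ) : mk6 a b c d e f 4 = e := rfl

@[simp] theorem mk6_five (a b c d e f : ℝ) : mk6 a b c d e f 5 = f := rfl

theorem smul_mk6 (t a b c d e f : ℝ) :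
    t • mk6 a b c d e f = mk6 (t * a) (t * b) (t * c) (t * d) (t * e) (t * f) := by
  ext i
  fin_cases i <;> rfl

section PhiEps

variable {e : Fin 3 → ℝ}

theorem sq_eq_one_of_sign (he : ∀ j, e j = 1 ∨ e j = -1) (j : Fin 3) : e j ^ 2 = 1 := by
  rcases he j with h | h <;> simp [h]

theorem Fq_PhiEps (he : ∀ j, e j = 1 ∨ e j = -1) (p : E6) : Fq (PhiEps e p) = Fq p := by
  simp [Fq, PhiEps, mul_pow, sq_eq_one_of_sign he]

theorem Gq_PhiEps (e : Fin 3 → ℝ) (p : E6) : Gq (PhiEps e p) = Gq p := by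
  simp [Gq, PhiEps]

theorem A1_PhiEps (he : ∀ j, e j = 1 ∨ e j = -1) (p : E6) : A1 (PhiEps e p) = A1 p := by
  simp [A1, PhiEps, mul_pow, sq_eq_one_of_sign he]

theorem A2_PhiEps (he : ∀ j, e j = 1 ∨ e j = -1) (p : E6) : A2 (PhiEps e p) = A2 p := by
  simp [A2, PhiEps, mul_pow, sq_eq_one_of_sign he]

theorem A3_PhiEps (he : ∀ j, e j = 1 ∨ e j = -1) (p : E6) : A3 (PhiEps e p) = A3 p := by
  simp [A3, PhiEps, mul_pow, sq_eq_one_of_sign he]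

theorem PhiEps_PhiEps (he : ∀ j, e j = 1 ∨ e j = -1) (p : E6) :
    PhiEps e (PhiEps e p) = p := by
  ext i
  fin_cases i <;> simp [PhiEps, ← mul_assoc, ← sq, sq_eq_one_of_sign he]

theorem PhiEps_mem_M4 (he : ∀ j, e j = 1 ∨ e j = -1) {p : E6} (hp : p ∈ M4) :
    PhiEps e p ∈ M4 := by
  have hne (j : Fin 3) : e j ≠ 0 := by rcases he j with h | h <;> simp [h]
  obtain ⟨hF, hG, h0, h1, h2, hy⟩ := hp
  refine ⟨by rw [Fq_PhiEps he, hF], by rw [Gq_PhiEps, hG], h0, h1, h2, ?_⟩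
  simpa [PhiEps, hne] using hy

theorem PhiEps_mem_ell (he : ∀ j, e j = 1 ∨ e j = -1) {p : E6} (hp : p ∈ ellM ∪ ellP) :
    PhiEps e p ∈ ellM ∪ ellP := by
  rcases hp with ⟨hM, s, hs, h0, h1, h2, h3, h4, h5⟩ | ⟨hM, s, hs, h0, h1, h2, h3, h4, h5⟩ <;>
    rcases he 1 with h | h
  · exact Or.inl ⟨PhiEps_mem_M4 he hM, s, hs, h0, h1, h2, by simp [PhiEps, h3, h4, h5, h]⟩
  · exact Or.inr ⟨PhiEps_mem_M4 he hM, s, hs, h0, h1, h2, by simp [PhiEps, h3, h4, h5, h]⟩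
  · exact Or.inr ⟨PhiEps_mem_M4 he hM, s, hs, h0, h1, h2, by simp [PhiEps, h3, h4, h5, h]⟩
  · exact Or.inl ⟨PhiEps_mem_M4 he hM, s, hs, h0, h1, h2, by simp [PhiEps, h3, h4, h5, h]⟩

theorem PhiEps_mem_Mt4 (he : ∀ j, e j = 1 ∨ e j = -1) {p : E6} (hp : p ∈ Mt4) :
    PhiEps e p ∈ Mt4 := by
  refine ⟨PhiEps_mem_M4 he hp.1, fun h => hp.2 ?_⟩
  simpa only [PhiEps_PhiEps he] using PhiEps_mem_ell he h

theorem PhiEps_X1 (he : ∀ j, e j = 1 ∨ e j = -1) (p : E6) :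
    PhiEps e (X1 p) = e 0 • X1 (PhiEps e p) := by
  have h := sq_eq_one_of_sign he 0
  rw [X1, X1, A1_PhiEps he, smul_mk6]
  simp only [PhiEps, mk6_zero, mk6_one, mk6_two, mk6_three, mk6_four, mk6_five]
  congr 1 <;> grind

theorem PhiEps_X2 (he : ∀ j, e j = 1 ∨ e j = -1) (p : E6) :
    PhiEps e (X2 p) = e 1 • X2 (PhiEps e p) := by
  have h := sq_eq_one_of_sign he 1
  rw [X2, X2, A2_PhiEps he, smul_mk6]
  simp only [PhiEps, mk6_zero, mk6_one, mk6_two, mk6_three, mk6_four, mk6_five]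
  congr 1 <;> grind

theorem PhiEps_X3 (he : ∀ j, e j = 1 ∨ e j = -1) (p : E6) :
    PhiEps e (X3 p) = e 2 • X3 (PhiEps e p) := by
  have h := sq_eq_one_of_sign he 2
  rw [X3, X3, A3_PhiEps he, smul_mk6]
  simp only [PhiEps, mk6_zero, mk6_one, mk6_two, mk6_three, mk6_four, mk6_five]
  congr 1 <;> grind

end PhiEps

/-- Proposition 3.4(i): `Φ^ε` preserves `M̃⁴` and, being linear, its differential sends
`X_j(p)` to `ε_j X_j(Φ^ε(p))`. -/
theorem statement_18 (e : Fin 3 → ℝ) (he : ∀ j, e j = 1 ∨ e j = -1) :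
    (∀ p ∈ Mt4, PhiEps e p ∈ Mt4) ∧
    (∀ p ∈ Mt4, ∀ j : Fin 3, PhiEps e (Xv j p) = e j • Xv j (PhiEps e p)) := by
  refine ⟨fun p hp => PhiEps_mem_Mt4 he hp, fun p _ j => ?_⟩
  fin_cases j
  · exact PhiEps_X1 he p
  · exact PhiEps_X2 he p
  · exact PhiEps_X3 he p
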